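/- (Area formula with respect to the Hausdorff measure.) Let X be a metric space, μ a Borel regular measure on X admitting a countable open cover by sets of finite μ-measure, α > 0, and A ⊆ X Borel with S_{μ,ζ_α} covering A finely. If H^α(A) < ∞ and μ restricted to A is absolutely continuous with respect to H^α restricted to A, then for every Borel set B ⊆ A: μ(B) = ∫_B s^α(μ,x) dH^α(x), where s^α(μ,x) is the Federer density of μ with respect to ζ_α(S) = c_α diam(S)^α. -/

import Mathlib

open Set Metric MeasureTheory ENNReal Filter Topology

variable {X : Type*}

section Defs
variable [MetricSpace X] [MeasurableSpace X]

/-- The `δ`-approximating pre-measure `ζ_δ` of the Carathéodory construction built from a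
family of sets `S` and a size function `ζ`: the infimum of `∑_j ζ(E_j)` over countable
covers of `R` by members `E_j ∈ S` of diameter at most `δ`. -/
noncomputable def caraPre (S : Set (Set X)) (ζ : Set X → ℝ≥0∞) (δ : ℝ≥0∞) (R : Set X) : ℝ≥0∞ :=
  ⨅ (E : ℕ → Set X) (_ : ∀ n, E n ∈ S ∧ EMetric.diam (E n) ≤ δ) (_ : R ⊆ ⋃ n, E n),
    ∑' n, ζ (E n)

/-- The Carathéodory approximating measure `ψ_ζ = sup_{δ>0} ζ_δ`. -/
noncomputable def psi (S : Set (Set X)) (ζ : Set X → ℝ≥0∞) (R : Set X) : ℝ≥0∞ :=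
  ⨆ (δ : ℝ≥0∞) (_ : 0 < δ), caraPre S ζ δ R

/-- The quotient function `Q_{μ,ζ}`. -/
noncomputable def fedQuot (μ : Measure X) (ζ : Set X → ℝ≥0∞) (T : Set X) : ℝ≥0∞ :=
  if ζ T = 0 then ∞ else if ζ T = ∞ then 0 else μ T / ζ T

/-- The family `S_{μ,ζ}`: members of `S` except those on which `ζ` and `μ` both vanish or
are both infinite. -/
def adm (μ : Measure X) (S : Set (Set X)) (ζ : Set X → ℝ≥0∞) : Set (Set X) :=
  {T ∈ S | ¬ (ζ T = 0 ∧ μ T = 0) ∧ ¬ (ζ T = ∞ ∧ μ T = ∞)}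

/-- A family of sets `𝒮` covers finely at `x` (equivalently, the associated covering
relation is fine at `x`). -/
def Fine (𝒮 : Set (Set X)) (x : X) : Prop :=
  ∀ ε : ℝ≥0∞, 0 < ε → ∃ T ∈ 𝒮, x ∈ T ∧ EMetric.diam T < ε

/-- The Federer density `F^ζ(μ,x)`: the covering limsup of `Q_{μ,ζ}` over members of
`S_{μ,ζ}` containing `x` with diameter tending to `0`. -/
noncomputable def fedDensity (μ : Measure X) (S : Set (Set X)) (ζ : Set X → ℝ≥0∞) (x : X) :
    ℝ≥0∞ :=
  ⨅ (ε : ℝ≥0∞) (_ : 0 < ε),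
    ⨆ (T : Set X) (_ : T ∈ adm μ S ζ ∧ x ∈ T ∧ EMetric.diam T < ε), fedQuot μ ζ T

/-- The size function `ζ_α(T) = c_α diam(T)^α`. -/
noncomputable def sizeDiam (c : ℝ≥0∞) (α : ℝ) (T : Set X) : ℝ≥0∞ :=
  c * EMetric.diam T ^ α

/-- The enlargement `Ŝ = ⋃ {T ∈ S : T ∩ S ≠ ∅, diam T ≤ 2 diam S}`. -/
def hatSet (S : Set (Set X)) (T : Set X) : Set X :=
  ⋃₀ {U | U ∈ S ∧ (U ∩ T).Nonempty ∧ EMetric.diam U ≤ 2 * EMetric.diam T}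

/-- The doubling-type condition on the size function `ζ`: there are constants `c, η > 0`
such that every `S ∈ 𝒮` admits `S̃ ∈ 𝒮` with `Ŝ ⊆ S̃`, `diam S̃ ≤ c diam S` and
`ζ(S̃) ≤ η ζ(S)`. -/
def DoublingSize (S : Set (Set X)) (ζ : Set X → ℝ≥0∞) : Prop :=
  ∃ c η : ℝ≥0∞, 0 < c ∧ c < ∞ ∧ 0 < η ∧ η < ∞ ∧
    ∀ T ∈ S, ∃ T' ∈ S, hatSet S T ⊆ T' ∧
      EMetric.diam T' ≤ c * EMetric.diam T ∧ ζ T' ≤ η * ζ T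

end Defs

/-- The family of all closed balls (with positive radius) of a metric space. -/
def closedBallsF (X : Type*) [MetricSpace X] : Set (Set X) :=
  {T | ∃ (x : X) (r : ℝ), 0 < r ∧ T = Metric.closedBall x r}

/-- The family of all closed subsets of a metric space. -/
def closedSetsF (X : Type*) [MetricSpace X] : Set (Set X) := {T | IsClosed T}

section DefsM
variable [MetricSpace X] [MeasurableSpace X]

/-- A (outer) measure `μ` is Borel regular if every set is contained in a Borel set of the
same measure. -/
def BorelRegular (μ : Measure X) : Prop :=
  ∀ A : Set X, ∃ B : Set X, MeasurableSet B ∧ A ⊆ B ∧ μ A = μ B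

/-- There exists a countable open cover of `X` whose elements have finite `μ`-measure. -/
def SigmaFiniteOpen (μ : Measure X) : Prop :=
  ∃ U : ℕ → Set X, (∀ n, IsOpen (U n)) ∧ (⋃ n, U n) = univ ∧ ∀ n, μ (U n) < ∞

/- The Carathéodory-construction measure `ψ_ζ` as a Borel measure, via the metric
construction (sets outside the family `S` are given infinite size). -/
open Classical in
noncomputable def psiM [MeasurableSpace X] [BorelSpace X] (S : Set (Set X))
    (ζ : Set X → ℝ≥0∞) : Measure X :=
  Measure.mkMetric' (fun T => if T ∈ S then ζ T else ∞)

/-- The upper (centered) spherical density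
`Θ^{*α}(μ,x) = limsup_{r→0⁺} μ(B̄(x,r))/(c_α (2r)^α)`. -/
noncomputable def upperSphDensity (μ : Measure X) (c : ℝ≥0∞) (α : ℝ) (x : X) : ℝ≥0∞ :=
  Filter.limsup
    (fun r : ℝ => μ (Metric.closedBall x r) / (c * ENNReal.ofReal (2 * r) ^ α)) (𝓝[>] 0)

/-- `X` is diametrically regular: for all `x ∈ X`, `R > 0` there is `δ > 0` such that
`t ↦ diam B(y,t)` is continuous on `(0,δ)` for every `y ∈ B̄(x,R)`. -/
def DiamRegular (X : Type*) [MetricSpace X] : Prop :=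
  ∀ x : X, ∀ R > (0:ℝ), ∃ δ > (0:ℝ), ∀ y ∈ Metric.closedBall x R,
    ContinuousOn (fun t : ℝ => Metric.diam (Metric.ball y t)) (Ioo 0 δ)

end DefsM



theorem emdiam_eq [MetricSpace X] (T : Set X) : EMetric.diam T = Metric.ediam T := rfl

theorem psiM_eq [MetricSpace X] [MeasurableSpace X] [BorelSpace X] (α : ℝ) (c : ℝ≥0∞) :
    psiM (closedSetsF X) (sizeDiam c α) = Measure.mkMetric (X := X) (fun d => c * d ^ α) := by
  classical
  have h : OuterMeasure.mkMetric' (fun T : Set X => if T ∈ closedSetsF X then sizeDiam c α T else ∞)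
      = OuterMeasure.mkMetric (X := X) (fun d => c * d ^ α) := by
    unfold OuterMeasure.mkMetric OuterMeasure.mkMetric'
    congr 1; ext1 r; congr 1; ext1 hr
    apply le_antisymm
    · rw [OuterMeasure.mkMetric'.le_pre]
      intro s hs
      refine (measure_mono (subset_closure (s := s))).trans ?_
      refine (OuterMeasure.mkMetric'.pre_le (by rwa [Metric.ediam_closure])).trans ?_
      rw [if_pos (show closure s ∈ closedSetsF X from isClosed_closure)]
      simp [sizeDiam, emdiam_eq]
    · rw [OuterMeasure.mkMetric'.le_pre]
      intro s hs
      refine (OuterMeasure.mkMetric'.pre_le hs).trans ?_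
      split_ifs
      · exact le_rfl
      · exact le_top
  ext s hs
  rw [← OuterMeasure.coe_mkMetric, ← h]
  unfold psiM Measure.mkMetric'
  rw [toMeasure_apply _ _ hs]

theorem psiM_le [MetricSpace X] [MeasurableSpace X] [BorelSpace X] (α : ℝ) (c : ℝ≥0∞)
    (E : Set X) (K : ℝ≥0∞)
    (h : ∀ δ : ℝ≥0∞, 0 < δ → ∃ u : Set (Set X), u.Countable ∧ ∃ (t : u → Set X), E ⊆ ⋃ i, t i ∧
      (∀ i, Metric.ediam (t i) ≤ δ) ∧ ∑' i, (c * Metric.ediam (t i) ^ α) ≤ K) :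
    psiM (closedSetsF X) (sizeDiam c α) E ≤ K := by
  rw [psiM_eq]
  choose! u hu t h1 h2 h3 using h
  have hpos : ∀ n : ℕ, 0 < ((n : ℝ≥0∞))⁻¹ := fun n => ENNReal.inv_pos.2 (ENNReal.natCast_ne_top _)
  have : ∀ n : ℕ, Countable (u ((n : ℝ≥0∞))⁻¹) := fun n => (hu _ (hpos n)).to_subtype
  have := Measure.mkMetric_le_liminf_tsum (X := X) E (l := atTop)
    (fun n : ℕ => ((n : ℝ≥0∞))⁻¹) ENNReal.tendsto_inv_nat_nhds_zero
    (fun n => t ((n : ℝ≥0∞))⁻¹) (Eventually.of_forall fun n => h2 _ (hpos n))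
    (Eventually.of_forall fun n => h1 _ (hpos n)) (fun d => c * d ^ α)
  refine this.trans ((liminf_le_liminf (Eventually.of_forall fun n => h3 _ (hpos n))).trans ?_)
  simp

/-- covers from Hausdorff measure -/
theorem psiM_cover [MetricSpace X] [MeasurableSpace X] [BorelSpace X] (α : ℝ) (c : ℝ≥0∞)
    (E : Set X) (K : ℝ≥0∞) (hK : psiM (closedSetsF X) (sizeDiam c α) E < K)
    (δ : ℝ≥0∞) (hδ : 0 < δ) : ∃ (t : ℕ → Set X), E ⊆ ⋃ i, t i ∧ (∀ i, IsClosed (t i)) ∧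
      (∀ i, Metric.ediam (t i) ≤ δ) ∧
      ∑' i, (⨆ _ : (t i).Nonempty, c * Metric.ediam (t i) ^ α) ≤ K := by
  rw [psiM_eq, Measure.mkMetric_apply] at hK
  have h1 := (le_iSup₂ (f := fun (r : ℝ≥0∞) (_ : 0 < r) => ⨅ (t : ℕ → Set X) (_ : E ⊆ iUnion t)
    (_ : ∀ n, ediam (t n) ≤ r), ∑' n, ⨆ _ : (t n).Nonempty, c * (ediam (t n)) ^ α) δ hδ).trans_lt hK
  simp only [iInf_lt_iff] at h1
  obtain ⟨t, h1, h2, h3⟩ := h1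
  refine ⟨fun i => closure (t i), ?_, fun i => isClosed_closure, ?_, ?_⟩
  · exact h1.trans (iUnion_mono fun i => subset_closure)
  · intro i; rw [Metric.ediam_closure]; exact h2 i
  · simp only [Metric.ediam_closure, closure_nonempty_iff]; exact h3.le

theorem upper_bound [MetricSpace X] [MeasurableSpace X] [BorelSpace X] (μ : Measure X)
    (α : ℝ) (c : ℝ≥0∞) (E : Set X) (s : ℝ≥0∞) (hs' : s ≠ ∞)
    (hE : ∀ x ∈ E, fedDensity μ (closedSetsF X) (sizeDiam c α) x < s) :
    μ E ≤ s * psiM (closedSetsF X) (sizeDiam c α) E := by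
  let F : ℕ → Set X := fun k => {x ∈ E | ∀ T ∈ adm μ (closedSetsF X) (sizeDiam c α), x ∈ T →
    Metric.ediam T < (k : ℝ≥0∞)⁻¹ → fedQuot μ (sizeDiam c α) T < s}
  have hmono : Monotone F := by
    intro k l hkl x hx
    exact ⟨hx.1, fun T hT hxT hd => hx.2 T hT hxT (hd.trans_le (by simpa using hkl))⟩
  have hU : E ⊆ ⋃ k, F k := by
    intro x hx
    have := hE x hx
    simp only [fedDensity, iInf_lt_iff] at this
    obtain ⟨ε, hε, h⟩ := this
    obtain ⟨n, hn⟩ := ENNReal.exists_inv_nat_lt hε.ne'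
    refine mem_iUnion.2 ⟨n, hx, fun T hT hxT hd => lt_of_le_of_lt ?_ h⟩
    exact le_iSup₂ (f := fun (T : Set X) (_ : T ∈ adm μ (closedSetsF X) (sizeDiam c α) ∧ x ∈ T ∧
      EMetric.diam T < ε) => fedQuot μ (sizeDiam c α) T) T ⟨hT, hxT, hd.trans hn⟩
  refine (measure_mono hU).trans ?_
  rw [hmono.measure_iUnion]
  refine iSup_le fun k => ?_
  rcases eq_empty_or_nonempty E with he | ⟨x₀, hx₀⟩
  · have : F k = ∅ := by
      apply eq_empty_of_subset_empty; intro x hx; rw [← he]; exact hx.1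
    simp [this]
  have hs : s ≠ 0 := ((zero_le).trans_lt (hE x₀ hx₀)).ne'
  have key : μ (F k) ≤ s * psiM (closedSetsF X) (sizeDiam c α) (F k) := by
    rw [mul_comm, ← ENNReal.div_le_iff_le_mul (Or.inl hs) (Or.inl hs')]
    refine le_of_forall_gt_imp_ge_of_dense fun K hK => ?_
    rw [ENNReal.div_le_iff_le_mul (Or.inl hs) (Or.inl hs'), mul_comm]
    have hlt : ((k + 1 : ℕ) : ℝ≥0∞)⁻¹ < (k : ℝ≥0∞)⁻¹ := by
      rw [ENNReal.inv_lt_inv]; exact_mod_cast Nat.lt_succ_self k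
    obtain ⟨t, h1, h2, h3, h4⟩ := psiM_cover α c (F k) K hK ((k + 1 : ℕ) : ℝ≥0∞)⁻¹
      (ENNReal.inv_pos.2 (ENNReal.natCast_ne_top _))
    have hsub : F k ⊆ ⋃ i, (t i ∩ F k) := by
      intro x hx
      obtain ⟨i, hi⟩ := mem_iUnion.1 (h1 hx)
      exact mem_iUnion.2 ⟨i, hi, hx⟩
    refine (measure_mono hsub).trans ((measure_iUnion_le _).trans ?_)
    refine le_trans ?_ (mul_le_mul_right h4 s)
    rw [← ENNReal.tsum_mul_left]
    refine ENNReal.tsum_le_tsum fun i => ?_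
    rcases eq_empty_or_nonempty (t i ∩ F k) with he | ⟨x, hxt, hxF⟩
    · simp [he]
    refine (measure_mono inter_subset_left).trans ?_
    rw [iSup_pos ⟨x, hxt⟩]
    change μ (t i) ≤ s * sizeDiam c α (t i)
    by_cases hadm : t i ∈ adm μ (closedSetsF X) (sizeDiam c α)
    · have hq := hxF.2 _ hadm hxt ((h3 i).trans_lt hlt)
      unfold fedQuot at hq
      split_ifs at hq with hz hz'
      · exact absurd hq not_top_lt
      · simp [hz', hs]
      · exact (ENNReal.div_le_iff_le_mul (Or.inl hz) (Or.inl hz')).1 hq.le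
    · have : ¬ (¬ (sizeDiam c α (t i) = 0 ∧ μ (t i) = 0) ∧
          ¬ (sizeDiam c α (t i) = ∞ ∧ μ (t i) = ∞)) := fun h => hadm ⟨h2 i, h⟩
      rw [not_and_or, not_not, not_not] at this
      rcases this with h | h
      · simp [h.2]
      · simp [h.1, hs]
  exact key.trans (mul_le_mul_right (measure_mono fun x hx => hx.1) _)

theorem dens_exists [MetricSpace X] [MeasurableSpace X] [BorelSpace X] (μ : Measure X)
    (α : ℝ) (c : ℝ≥0∞) (x : X) (s : ℝ≥0∞)
    (hx : s < fedDensity μ (closedSetsF X) (sizeDiam c α) x) (ε : ℝ≥0∞) (hε : 0 < ε) :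
    ∃ T : Set X, IsClosed T ∧ x ∈ T ∧ Metric.ediam T < ε ∧ s * (c * Metric.ediam T ^ α) ≤ μ T ∧
      0 < μ T := by
  have h := hx.trans_le (iInf₂_le ε hε)
  simp only [lt_iSup_iff] at h
  obtain ⟨T, ⟨hT, hxT, hd⟩, hq⟩ := h
  refine ⟨T, hT.1, hxT, hd, ?_⟩
  change s * sizeDiam c α T ≤ μ T ∧ _
  unfold fedQuot at hq
  split_ifs at hq with hz hz'
  · refine ⟨by simp [hz], ?_⟩
    rw [pos_iff_ne_zero]
    exact fun h0 => hT.2.1 ⟨hz, h0⟩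
  · exact absurd hq ENNReal.not_lt_zero
  · have := (ENNReal.lt_div_iff_mul_lt (Or.inl hz) (Or.inl hz')).1 hq
    exact ⟨this.le, (zero_le).trans_lt this⟩

theorem outerReg [MetricSpace X] [MeasurableSpace X] [BorelSpace X] (μ : Measure X)
    (hσ : SigmaFiniteOpen μ) : μ.OuterRegular := by
  obtain ⟨U, h1, h2, h3⟩ := hσ
  refine Measure.OuterRegular.of_restrict (s := U) (fun n => ?_) h1 h2.ge
  have : Fact (μ (U n) < ∞) := ⟨h3 n⟩
  infer_instance

theorem sigmaFin [MetricSpace X] [MeasurableSpace X] [BorelSpace X] (μ : Measure X)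
    (hσ : SigmaFiniteOpen μ) : SigmaFinite μ := by
  obtain ⟨U, h1, h2, h3⟩ := hσ
  exact ⟨⟨⟨U, fun _ => trivial, h3, h2⟩⟩⟩

theorem lower_bound [MetricSpace X] [MeasurableSpace X] [BorelSpace X] (μ : Measure X)
    (hσ : SigmaFiniteOpen μ) (α : ℝ) (hα : 0 < α) (c : ℝ≥0∞)
    (E : Set X) (s : ℝ≥0∞) (hs : s ≠ 0) (hs' : s ≠ ∞)
    (hE : ∀ x ∈ E, s < fedDensity μ (closedSetsF X) (sizeDiam c α) x) :
    s * psiM (closedSetsF X) (sizeDiam c α) E ≤ μ E := by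
  classical
  have := outerReg μ hσ
  have := sigmaFin μ hσ
  refine le_of_forall_gt_imp_ge_of_dense fun K hK => ?_
  obtain ⟨U, hEU, hUo, hUK⟩ := E.exists_isOpen_lt_of_lt K hK
  refine le_trans ?_ hUK.le
  rw [mul_comm, ← ENNReal.le_div_iff_mul_le (Or.inl hs) (Or.inl hs')]
  have hUs : μ U / s ≠ ∞ := ENNReal.div_ne_top (hUK.trans_le le_top).ne hs
  refine ENNReal.le_of_forall_pos_le_add fun ε hε _ => ?_
  refine psiM_le α c E _ fun δ hδ => ?_
  obtain ⟨ρ, hρ, hρ', hρδ⟩ : ∃ ρ : ℝ≥0∞, 0 < ρ ∧ ρ ≠ ∞ ∧ 5 * ρ ≤ δ := by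
    refine ⟨min δ 1 / 5, ENNReal.div_pos (by simp [hδ.ne']) (by simp), ?_, ?_⟩
    · exact ENNReal.div_ne_top (by simp) (by simp)
    · rw [ENNReal.mul_div_cancel (by simp) (by simp)]; exact min_le_left _ _
  let t : Set (Set X) := {T | IsClosed T ∧ T.Nonempty ∧ T ⊆ U ∧ Metric.ediam T ≤ ρ ∧
    s * (c * Metric.ediam T ^ α) ≤ μ T ∧ 0 < μ T}
  obtain ⟨u, hut, hdisj, hcov⟩ := Vitali.exists_disjoint_subfamily_covering_enlargement
    (fun T : Set X => T) t (fun T => (Metric.ediam T).toReal) 2 one_lt_two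
    (fun _ _ => ENNReal.toReal_nonneg) ρ.toReal
    (fun T hT => ENNReal.toReal_mono hρ' hT.2.2.2.1) (fun T hT => hT.2.1)
  have hm : ∀ i : u, MeasurableSet (i : Set X) := fun i => (hut i.2).1.measurableSet
  have hdis : Pairwise (Function.onFun Disjoint fun i : u => (i : Set X)) :=
    fun i j hij => hdisj i.2 j.2 (fun h => hij (Subtype.ext h))
  have hcount : u.Countable := by
    have := Measure.countable_meas_pos_of_disjoint_iUnion (μ := μ) hm hdis
    have h2 : {i : u | 0 < μ (i : Set X)} = univ := by
      ext i; simpa using (hut i.2).2.2.2.2.2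
    rw [h2, Set.countable_univ_iff] at this
    exact Set.countable_coe_iff.1 this
  have := hcount.to_subtype
  have hsum : ∑' i : u, c * Metric.ediam (i : Set X) ^ α ≤ μ U / s := by
    rw [ENNReal.le_div_iff_mul_le (Or.inl hs) (Or.inl hs'), mul_comm, ← ENNReal.tsum_mul_left]
    calc _ ≤ ∑' i : u, μ (i : Set X) := ENNReal.tsum_le_tsum fun i => (hut i.2).2.2.2.2.1
      _ = μ (⋃ i : u, (i : Set X)) := (measure_iUnion hdis hm).symm
      _ ≤ μ U := measure_mono (iUnion_subset fun i => (hut i.2).2.2.1)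
  have hfinsum : ∑' i : u, (5 : ℝ≥0∞) ^ α * (c * Metric.ediam (i : Set X) ^ α) ≠ ∞ := by
    rw [ENNReal.tsum_mul_left]
    exact ENNReal.mul_ne_top (ENNReal.rpow_ne_top_of_nonneg hα.le (by simp))
      (ne_top_of_le_ne_top hUs hsum)
  have htail := ENNReal.tendsto_tsum_compl_atTop_zero hfinsum
  obtain ⟨w, hw⟩ := (htail.eventually (gt_mem_nhds
    (show (0 : ℝ≥0∞) < ε by exact_mod_cast hε))).exists
  have hed : ∀ i : u, (((2 * Metric.ediam (i : Set X)).toNNReal : NNReal) : ℝ≥0∞) =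
      2 * Metric.ediam (i : Set X) := fun i => ENNReal.coe_toNNReal
        (ENNReal.mul_ne_top (by simp) (ne_top_of_le_ne_top hρ' (hut i.2).2.2.2.1))
  let t' : u → Set X := fun i => if i ∈ w then (i : Set X) else
    Metric.cthickening ((2 * Metric.ediam (i : Set X)).toNNReal : NNReal) (i : Set X)
  have hthick : ∀ i : u, Metric.ediam (Metric.cthickening
      ((2 * Metric.ediam (i : Set X)).toNNReal : NNReal) (i : Set X)) ≤
      5 * Metric.ediam (i : Set X) := by
    intro i
    refine (Metric.ediam_cthickening_le _).trans_eq ?_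
    rw [hed]; ring
  refine ⟨u, hcount, t', ?_, ?_, ?_⟩
  · intro x hx
    by_cases hxw : x ∈ ⋃ i ∈ w, (i : Set X)
    · simp only [mem_iUnion] at hxw
      obtain ⟨i, hi, hxi⟩ := hxw
      refine mem_iUnion.2 ⟨i, ?_⟩
      simp only [t', if_pos hi]; exact hxi
    · have hcl : IsClosed (⋃ i ∈ w, (i : Set X)) :=
        w.finite_toSet.isClosed_biUnion fun i _ => (hut i.2).1
      have hV : IsOpen (U ∩ (⋃ i ∈ w, (i : Set X))ᶜ) := hUo.inter hcl.isOpen_compl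
      obtain ⟨η, hη, hball⟩ := EMetric.isOpen_iff.1 hV x ⟨hEU hx, hxw⟩
      obtain ⟨T, hTc, hxT, hTd, hTm, hTp⟩ := dens_exists μ α c x s (hE x hx) (min η ρ)
        (lt_min hη hρ)
      have hTV : T ⊆ U ∩ (⋃ i ∈ w, (i : Set X))ᶜ := fun y hy => hball
        ((Metric.edist_le_ediam_of_mem hy hxT).trans_lt (hTd.trans_le (min_le_left _ _)))
      have hTt : T ∈ t := ⟨hTc, ⟨x, hxT⟩, hTV.trans inter_subset_left,
        hTd.le.trans (min_le_right _ _), hTm, hTp⟩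
      obtain ⟨b, hb, ⟨y, hyT, hyb⟩, hTb⟩ := hcov T hTt
      have hbw : (⟨b, hb⟩ : u) ∉ w := fun h =>
        (hTV hyT).2 (mem_iUnion₂.2 ⟨⟨b, hb⟩, h, hyb⟩)
      refine mem_iUnion.2 ⟨⟨b, hb⟩, ?_⟩
      simp only [t', if_neg hbw]
      rw [Metric.mem_cthickening_iff, ENNReal.ofReal_coe_nnreal, hed ⟨b, hb⟩]
      refine (Metric.infEDist_le_edist_of_mem hyb).trans
        ((Metric.edist_le_ediam_of_mem hxT hyT).trans ?_)
      have hbf : 2 * Metric.ediam b ≠ ∞ :=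
        ENNReal.mul_ne_top (by simp) (ne_top_of_le_ne_top hρ' (hut hb).2.2.2.1)
      rw [← ENNReal.toReal_le_toReal (ne_top_of_le_ne_top hρ' hTt.2.2.2.1) hbf,
        ENNReal.toReal_mul]
      simpa using hTb
  · intro i
    have h5 : 5 * Metric.ediam (i : Set X) ≤ δ :=
      (mul_le_mul_right (hut i.2).2.2.2.1 5).trans hρδ
    by_cases hi : i ∈ w
    · simp only [t', if_pos hi]
      refine le_trans ?_ h5
      exact le_mul_of_one_le_left zero_le (by norm_num)
    · simp only [t', if_neg hi]
      exact (hthick i).trans h5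
  · have hle : ∀ i : u, c * Metric.ediam (t' i) ^ α ≤ c * Metric.ediam (i : Set X) ^ α +
        Set.indicator {i : u | i ∉ w}
          (fun i : u => (5 : ℝ≥0∞) ^ α * (c * Metric.ediam (i : Set X) ^ α)) i := by
      intro i
      by_cases hi : i ∈ w
      · simp only [t', if_pos hi]; exact le_self_add
      · rw [Set.indicator_of_mem (show i ∈ {i : u | i ∉ w} from hi)]
        simp only [t', if_neg hi]
        refine le_add_left ?_
        calc c * _ ≤ c * (5 * Metric.ediam (i : Set X)) ^ α := by
              gcongr; exact hthick i
          _ = _ := by rw [ENNReal.mul_rpow_of_nonneg _ _ hα.le]; ring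
    refine (ENNReal.tsum_le_tsum hle).trans ?_
    rw [ENNReal.tsum_add]
    refine add_le_add hsum ?_
    rw [← tsum_subtype]
    exact hw.le

/-- Two densities comparable through level sets coincide almost everywhere. -/
theorem ae_eq_of_levels [MeasurableSpace X] (μ H : Measure X) (A : Set X)
    (hA : MeasurableSet A) (hfin : H A < ∞) (f g : X → ℝ≥0∞) (hg : Measurable g)
    (hμ : ∀ M ⊆ A, MeasurableSet M → μ M = ∫⁻ x in M, g x ∂H)
    (hup : ∀ E : Set X, ∀ s : ℝ≥0∞, s ≠ ∞ → E ⊆ A → (∀ x ∈ E, f x < s) → μ E ≤ s * H E)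
    (hlo : ∀ E : Set X, ∀ s : ℝ≥0∞, s ≠ 0 → s ≠ ∞ → E ⊆ A → (∀ x ∈ E, s < f x) →
      s * H E ≤ μ E) : ∀ᵐ x ∂H, x ∈ A → f x = g x := by
  have hcancel : ∀ (E : Set X) (p q : ℝ≥0∞), E ⊆ A → p < q → q * H E ≤ p * H E → H E = 0 := by
    intro E p q hE hpq h
    by_contra h0
    exact absurd h (not_le.2
      (ENNReal.mul_lt_mul_left h0 ((measure_mono hE).trans_lt hfin).ne hpq))
  have h1 : ∀ p q : ℚ, ENNReal.ofReal p < ENNReal.ofReal q →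
      H {x ∈ A | f x < ENNReal.ofReal p ∧ ENNReal.ofReal q < g x} = 0 := by
    intro p q hpq
    set E := {x ∈ A | f x < ENNReal.ofReal p ∧ ENNReal.ofReal q < g x}
    have hEA : E ⊆ A := fun x hx => hx.1
    refine hcancel E _ _ hEA hpq (le_trans ?_ (hup E _ ENNReal.ofReal_ne_top hEA fun x hx => hx.2.1))
    let M := toMeasurable μ E ∩ (A ∩ {x | ENNReal.ofReal q < g x})
    have hgm : MeasurableSet {x | ENNReal.ofReal q < g x} := measurableSet_lt measurable_const hg
    have hM : MeasurableSet M := (measurableSet_toMeasurable μ E).inter (hA.inter hgm)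
    have hEM : E ⊆ M := fun x hx => ⟨subset_toMeasurable μ E hx, hx.1, hx.2.2⟩
    calc ENNReal.ofReal q * H E ≤ ENNReal.ofReal q * H M := mul_le_mul_right (measure_mono hEM) _
      _ = ∫⁻ x in M, ENNReal.ofReal q ∂H := by rw [setLIntegral_const]
      _ ≤ ∫⁻ x in M, g x ∂H := setLIntegral_mono hg fun x hx => hx.2.2.le
      _ = μ M := (hμ M (fun x hx => hx.2.1) hM).symm
      _ ≤ μ (toMeasurable μ E) := measure_mono inter_subset_left
      _ = μ E := measure_toMeasurable E
  have h2 : ∀ p q : ℚ, ENNReal.ofReal p < ENNReal.ofReal q →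
      H {x ∈ A | g x < ENNReal.ofReal p ∧ ENNReal.ofReal q < f x} = 0 := by
    intro p q hpq
    set E := {x ∈ A | g x < ENNReal.ofReal p ∧ ENNReal.ofReal q < f x}
    have hEA : E ⊆ A := fun x hx => hx.1
    have hq : ENNReal.ofReal q ≠ 0 := ((zero_le).trans_lt hpq).ne'
    refine hcancel E _ _ hEA hpq ((hlo E _ hq ENNReal.ofReal_ne_top hEA fun x hx => hx.2.2).trans ?_)
    let M := toMeasurable H E ∩ (A ∩ {x | g x < ENNReal.ofReal p})
    have hgm : MeasurableSet {x | g x < ENNReal.ofReal p} := measurableSet_lt hg measurable_const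
    have hM : MeasurableSet M := (measurableSet_toMeasurable H E).inter (hA.inter hgm)
    have hEM : E ⊆ M := fun x hx => ⟨subset_toMeasurable H E hx, hx.1, hx.2.1⟩
    calc μ E ≤ μ M := measure_mono hEM
      _ = ∫⁻ x in M, g x ∂H := hμ M (fun x hx => hx.2.1) hM
      _ ≤ ∫⁻ x in M, ENNReal.ofReal p ∂H := setLIntegral_mono measurable_const fun x hx => hx.2.2.le
      _ = ENNReal.ofReal p * H M := by rw [setLIntegral_const]
      _ ≤ ENNReal.ofReal p * H (toMeasurable H E) :=
          mul_le_mul_right (measure_mono inter_subset_left) _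
      _ = _ := by rw [measure_toMeasurable]
  have hb : ∀ a b : ℝ≥0∞, a < b → ∃ p q : ℚ, ENNReal.ofReal p < ENNReal.ofReal q ∧
      a < ENNReal.ofReal p ∧ ENNReal.ofReal q < b := by
    intro a b hab
    obtain ⟨p, _, hp1, hp2⟩ := ENNReal.lt_iff_exists_rat_btwn.1 hab
    obtain ⟨q, _, hq1, hq2⟩ := ENNReal.lt_iff_exists_rat_btwn.1 hp2
    exact ⟨p, q, hq1, hp1, hq2⟩
  have e1 : ∀ᵐ x ∂H, ∀ p q : ℚ, ENNReal.ofReal p < ENNReal.ofReal q →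
      ¬ (x ∈ A ∧ f x < ENNReal.ofReal p ∧ ENNReal.ofReal q < g x) := by
    rw [ae_all_iff]; intro p; rw [ae_all_iff]; intro q
    by_cases hpq : ENNReal.ofReal p < ENNReal.ofReal q
    · filter_upwards [measure_eq_zero_iff_ae_notMem.1 (h1 p q hpq)] with x hx _ using hx
    · exact Eventually.of_forall fun x h => absurd h hpq
  have e2 : ∀ᵐ x ∂H, ∀ p q : ℚ, ENNReal.ofReal p < ENNReal.ofReal q →
      ¬ (x ∈ A ∧ g x < ENNReal.ofReal p ∧ ENNReal.ofReal q < f x) := by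
    rw [ae_all_iff]; intro p; rw [ae_all_iff]; intro q
    by_cases hpq : ENNReal.ofReal p < ENNReal.ofReal q
    · filter_upwards [measure_eq_zero_iff_ae_notMem.1 (h2 p q hpq)] with x hx _ using hx
    · exact Eventually.of_forall fun x h => absurd h hpq
  filter_upwards [e1, e2] with x hx1 hx2 hxA
  apply le_antisymm
  · by_contra hlt
    obtain ⟨p, q, hpq, hap, hqb⟩ := hb _ _ (not_le.1 hlt)
    exact hx2 p q hpq ⟨hxA, hap, hqb⟩
  · by_contra hlt
    obtain ⟨p, q, hpq, hap, hqb⟩ := hb _ _ (not_le.1 hlt)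
    exact hx1 p q hpq ⟨hxA, hap, hqb⟩

/-- Area formula with respect to the Hausdorff measure. If `μ` is a
Borel regular measure admitting a countable open cover by sets of finite measure, `A` is
Borel, `S_{μ,ζ_α}` covers `A` finely, `H^α(A) < ∞` and `μ⌊A ≪ H^α⌊A`, then
`μ(B) = ∫_B s^α(μ,x) dH^α(x)` for every Borel `B ⊆ A`. -/
theorem stmt8 [MetricSpace X] [MeasurableSpace X] [BorelSpace X]
    (μ : Measure X) (hreg : BorelRegular μ) (hσ : SigmaFiniteOpen μ)
    (α : ℝ) (hα : 0 < α) (c : ℝ≥0∞) (hc : 0 < c) (hc' : c < ∞)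
    (A : Set X) (hA : MeasurableSet A)
    (hfine : ∀ x ∈ A, Fine (adm μ (closedSetsF X) (sizeDiam c α)) x)
    (hfin : psiM (closedSetsF X) (sizeDiam c α) A < ∞)
    (habs : μ.restrict A ≪ (psiM (closedSetsF X) (sizeDiam c α)).restrict A) :
    ∀ B ⊆ A, MeasurableSet B →
      μ B = ∫⁻ x in B, fedDensity μ (closedSetsF X) (sizeDiam c α) x
        ∂(psiM (closedSetsF X) (sizeDiam c α)) := by
  have := sigmaFin μ hσ
  set H : Measure X := psiM (closedSetsF X) (sizeDiam c α) with hH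
  have : IsFiniteMeasure (H.restrict A) := ⟨by simpa using hfin⟩
  have hrn := Measure.withDensity_rnDeriv_eq (μ.restrict A) (H.restrict A) habs
  set g := (μ.restrict A).rnDeriv (H.restrict A) with hg
  have hgm : Measurable g := Measure.measurable_rnDeriv _ _
  have hμ : ∀ M ⊆ A, MeasurableSet M → μ M = ∫⁻ x in M, g x ∂H := by
    intro M hMA hM
    have h1 := congrArg (fun ν : Measure X => ν M) hrn
    simp only [withDensity_apply _ hM, Measure.restrict_restrict hM, Measure.restrict_apply hM,
      inter_eq_self_of_subset_left hMA] at h1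
    exact h1.symm
  have hae := ae_eq_of_levels μ H A hA hfin
    (fedDensity μ (closedSetsF X) (sizeDiam c α)) g hgm hμ
    (fun E s hs' _ hE => upper_bound μ α c E s hs' hE)
    (fun E s hs hs' _ hE => lower_bound μ hσ α hα c E s hs hs' hE)
  intro B hBA hB
  rw [hμ B hBA hB]
  refine lintegral_congr_ae ?_
  filter_upwards [ae_restrict_of_ae hae, ae_restrict_mem hB] with x hx hxB
  exact (hx (hBA hxB)).symm
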